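/- Let K ≥ 2, let θ_1, …, θ_K be independent Gaussian random variables with θ_i ∼ N(μ̂_i, 1/N_i) for integers N_i ≥ 1, and let π maximize the M=2 ReMax objective J(π) = Σ_{i,j} π_i π_j E[max(θ_i, θ_j)] (with the diagonal convention E[max(θ_i, θ_i)] = μ̂_i) over the probability simplex Δ^{K-1}. Fix an arm j ≠ 1, reals μ₁ > μ_j with gap Δ_j := μ₁ − μ_j, a real T_j > 0, and 0 < ε ≤ Δ_j/4. If μ̂_1 ≥ μ₁ − ε, μ̂_j ≤ μ_j + ε, N_1 ≥ 3·T_j, and N_j ≥ 3·T_j, then π_j ≤ (8/(√π · Δ_j)) · exp( −1.5·T_j·(Δ_j − 2ε)²/2 ). -/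

import Mathlib

open MeasureTheory ProbabilityTheory
open scoped NNReal

/-- The joint posterior: independent Gaussian coordinates `θ_i ∼ N(μ̂_i, 1/N_i)`. -/
noncomputable def gaussPosterior (K : ℕ) (μhat : Fin K → ℝ) (N : Fin K → ℕ) :
    Measure (Fin K → ℝ) :=
  Measure.pi fun i => gaussianReal (μhat i) ((N i : ℝ≥0))⁻¹

/-- The `M = 2` ReMax objective `J(π) = Σ_{i,j} π_i π_j E[max(θ_i, θ_j)]`, where a
repeated draw of the same arm reuses the same posterior sample (so the diagonal term is
`E[θ_i] = μ̂_i`). -/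
noncomputable def remaxJ2 (K : ℕ) (μhat : Fin K → ℝ) (N : Fin K → ℕ)
    (π : Fin K → ℝ) : ℝ :=
  ∫ θ, ∑ i, ∑ j, π i * π j * max (θ i) (θ j) ∂(gaussPosterior K μhat N)

lemma aux_gauss (D : ℝ) (hD : 0 ≤ D) (v : ℝ≥0) (hv : v ≠ 0) (hv2 : (v : ℝ) ≤ 2) :
    ∫ x, max x 0 ∂(gaussianReal (-D) v) ≤ Real.exp (-D ^ 2 / (2 * v)) := by
  have hvpos : (0 : ℝ) < v := by positivity
  have hsq : ∫ x, x ^ 2 ∂(gaussianReal 0 v) = v := by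
    have h := variance_id_gaussianReal (μ := 0) (v := v)
    rw [variance_eq_integral (by fun_prop)] at h
    simpa [integral_id_gaussianReal] using h
  have hint2 : Integrable (fun x : ℝ => x ^ 2) (gaussianReal 0 v) :=
    (memLp_id_gaussianReal (μ := 0) (v := v) 2).integrable_sq
  have hint1 : Integrable (fun x : ℝ => x) (gaussianReal 0 v) :=
    (memLp_id_gaussianReal (μ := 0) (v := v) 1).integrable (by norm_num)
  have hg : ∫ x, (x ^ 2 / 4 + x / 2 + 1 / 4) ∂(gaussianReal 0 v) = (v : ℝ) / 4 + 1 / 4 := by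
    have hs : Integrable (fun x : ℝ => x ^ 2 / 4 + x / 2) (gaussianReal 0 v) :=
      (hint2.div_const 4).add (hint1.div_const 2)
    rw [integral_add hs (integrable_const _),
      integral_add (hint2.div_const 4) (hint1.div_const 2), integral_div, integral_div, hsq,
      integral_id_gaussianReal]
    simp
  rw [integral_gaussianReal_eq_integral_smul hv] at hg ⊢
  have hI : Integrable (fun x : ℝ => gaussianPDFReal 0 v x • (x ^ 2 / 4 + x / 2 + 1 / 4)) := by
    by_contra hcon
    rw [integral_undef hcon] at hg
    linarith
  have key : ∫ x, gaussianPDFReal (-D) v x • max x 0 ≤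
      ∫ x, Real.exp (-D ^ 2 / (2 * v)) *
        (gaussianPDFReal 0 v x • (x ^ 2 / 4 + x / 2 + 1 / 4)) := by
    refine integral_mono_of_nonneg (ae_of_all _ fun x => ?_) (hI.const_mul _)
      (ae_of_all _ fun x => ?_)
    · exact mul_nonneg (gaussianPDFReal_nonneg _ _ _) (le_max_right _ _)
    · simp only [smul_eq_mul]
      rcases le_total x 0 with hx | hx
      · rw [max_eq_right hx, mul_zero]
        have := gaussianPDFReal_nonneg 0 v x
        have h3 : 0 ≤ x ^ 2 / 4 + x / 2 + 1 / 4 := by nlinarith [sq_nonneg (x + 1)]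
        positivity
      · rw [max_eq_left hx]
        have h3 : x ≤ x ^ 2 / 4 + x / 2 + 1 / 4 := by nlinarith [sq_nonneg (x - 1)]
        have h4 : gaussianPDFReal (-D) v x ≤
            Real.exp (-D ^ 2 / (2 * v)) * gaussianPDFReal 0 v x := by
          simp only [gaussianPDFReal]
          rw [mul_left_comm, ← Real.exp_add]
          refine mul_le_mul_of_nonneg_left (Real.exp_le_exp.2 ?_) (by positivity)
          rw [← add_div]
          refine div_le_div_of_nonneg_right ?_ (by positivity)
          nlinarith [mul_nonneg hD hx]
        rw [← mul_assoc]
        exact mul_le_mul h4 h3 hx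
          (mul_nonneg (Real.exp_nonneg _) (gaussianPDFReal_nonneg _ _ _))
  rw [integral_const_mul, hg] at key
  refine key.trans ?_
  have := Real.exp_nonneg (-D ^ 2 / (2 * v))
  nlinarith

lemma aux_lin {K : ℕ} (a b : Fin K) (π h : Fin K → ℝ) (p : ℝ) :
    ∑ k, (π k + p * ((if k = a then 1 else 0) - (if k = b then 1 else 0))) * h k
      = ∑ k, π k * h k + p * (h a - h b) := by
  have : ∀ k, (π k + p * ((if k = a then 1 else 0) - (if k = b then 1 else 0))) * h k
      = π k * h k + p * ((if k = a then h k else 0) - (if k = b then h k else 0)) := by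
    intro k
    split_ifs <;> ring
  simp only [this, Finset.sum_add_distrib, ← Finset.mul_sum, Finset.sum_sub_distrib]
  simp

lemma aux_path {K : ℕ} (a b : Fin K) (hab : b ≠ a) (π θ : Fin K → ℝ) (hπ0 : ∀ i, 0 ≤ π i)
    (hπ1 : ∑ i, π i = 1) (π' : Fin K → ℝ)
    (hπ' : π' = fun k => π k + π b * ((if k = a then 1 else 0) - (if k = b then 1 else 0))) :
    π b ^ 2 * (θ a - θ b) - 2 * π b * max (θ b - θ a) 0 +
      ∑ i, ∑ k, π i * π k * max (θ i) (θ k) ≤ ∑ i, ∑ k, π' i * π' k * max (θ i) (θ k) := by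
  set p := π b with hp
  have hp0 : 0 ≤ p := hπ0 b
  set u := max (θ b - θ a) 0 with hu
  have hu0 : 0 ≤ u := le_max_right _ _
  have hu1 : θ b - θ a ≤ u := le_max_left _ _
  have hm : max (θ a) (θ b) = θ a + u := by
    rw [hu, ← max_add_add_left]
    rw [max_comm]; congr 1 <;> ring
  have e1 : ∑ i, ∑ k, π' i * π' k * max (θ i) (θ k)
      = ∑ i, π' i * (∑ k, π' k * max (θ i) (θ k)) := by
    simp only [Finset.mul_sum, mul_assoc]
  have e2 : ∑ i, ∑ k, π i * π k * max (θ i) (θ k)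
      = ∑ i, π i * (∑ k, π k * max (θ i) (θ k)) := by
    simp only [Finset.mul_sum, mul_assoc]
  rw [e1, e2]
  have e3 : ∀ i, ∑ k, π' k * max (θ i) (θ k)
      = ∑ k, π k * max (θ i) (θ k) + p * (max (θ i) (θ a) - max (θ i) (θ b)) := by
    intro i
    rw [hπ']
    exact aux_lin a b π (fun k => max (θ i) (θ k)) p
  simp only [e3]
  rw [hπ', aux_lin a b π (fun i => ∑ k, π k * max (θ i) (θ k)
    + p * (max (θ i) (θ a) - max (θ i) (θ b))) p]
  set S := ∑ k, π k * (max (θ k) (θ a) - max (θ k) (θ b)) with hS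
  have e4 : ∑ i, π i * (∑ k, π k * max (θ i) (θ k) + p * (max (θ i) (θ a) - max (θ i) (θ b)))
      = ∑ i, π i * (∑ k, π k * max (θ i) (θ k)) + p * S := by
    rw [hS, Finset.mul_sum, ← Finset.sum_add_distrib]
    exact Finset.sum_congr rfl fun i _ => by ring
  have e5 : ∑ k, π k * max (θ a) (θ k) - ∑ k, π k * max (θ b) (θ k) = S := by
    rw [hS, ← Finset.sum_sub_distrib]
    refine Finset.sum_congr rfl fun i _ => ?_
    rw [max_comm (θ i), max_comm (θ i)]; ring
  have e6 : -u + p * (θ a - θ b + 2 * u) ≤ S := by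
    have : ∑ k, π k * (-u + if k = b then (θ a - θ b + 2 * u) else 0)
        = -u + p * (θ a - θ b + 2 * u) := by
      simp only [mul_add, Finset.sum_add_distrib, ← Finset.sum_mul, hπ1]
      simp [hp]
      ring
    rw [← this, hS]
    refine Finset.sum_le_sum fun k _ => mul_le_mul_of_nonneg_left ?_ (hπ0 k)
    split_ifs with hk
    · subst hk
      rw [max_comm, hm, max_self]; linarith
    · have : max (θ k) (θ b) ≤ max (θ k) (θ a) + u := by
        refine max_le ?_ ?_
        · linarith [le_max_left (θ k) (θ a)]
        · linarith [le_max_right (θ k) (θ a)]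
      linarith
  rw [e4]
  rw [max_self, max_self, max_comm (θ b) (θ a), hm]
  nlinarith [mul_le_mul_of_nonneg_left e6 hp0, mul_nonneg (mul_nonneg hp0 hp0) hu0]

lemma aux_law {K : ℕ} (μhat : Fin K → ℝ) (N : Fin K → ℕ) (a b : Fin K) (hab : b ≠ a) :
    (gaussPosterior K μhat N).map (fun θ => θ b - θ a) =
      gaussianReal (-(μhat a - μhat b)) ((N b : ℝ≥0)⁻¹ + (N a : ℝ≥0)⁻¹) := by
  have hev : ∀ i, (gaussPosterior K μhat N).map (fun θ => θ i)
      = gaussianReal (μhat i) ((N i : ℝ≥0))⁻¹ := fun i =>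
    (measurePreserving_eval (fun i => gaussianReal (μhat i) ((N i : ℝ≥0))⁻¹) i).map_eq
  have hind : iIndepFun (fun i (θ : Fin K → ℝ) => θ i) (gaussPosterior K μhat N) :=
    iIndepFun_pi (X := fun _ x => x) (fun _ => aemeasurable_id)
  have h2 : IndepFun (fun θ : Fin K → ℝ => θ b) (fun θ => - θ a) (gaussPosterior K μhat N) :=
    (hind.indepFun hab).comp (φ := fun x => x) (ψ := fun x => -x) measurable_id measurable_neg
  have h3 : (gaussPosterior K μhat N).map (fun θ => - θ a)
      = gaussianReal (-μhat a) ((N a : ℝ≥0))⁻¹ := by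
    rw [← gaussianReal_map_neg, ← hev a, Measure.map_map (by fun_prop) (by fun_prop)]
    rfl
  have h4 := gaussianReal_add_gaussianReal_of_indepFun h2 (hev b) h3
  convert h4 using 2
  · ext θ; simp [sub_eq_add_neg]
  · ring

instance aux_prob {K : ℕ} (μhat : Fin K → ℝ) (N : Fin K → ℕ) :
    IsProbabilityMeasure (gaussPosterior K μhat N) := by
  unfold gaussPosterior; infer_instance

lemma aux_int {K : ℕ} (μhat : Fin K → ℝ) (N : Fin K → ℕ) (i : Fin K) :
    Integrable (fun θ => θ i) (gaussPosterior K μhat N) :=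
  integrable_comp_eval (μ := fun i => gaussianReal (μhat i) ((N i : ℝ≥0))⁻¹) (f := fun x : ℝ => x)
    ((memLp_id_gaussianReal 1).integrable (by norm_num))

lemma aux_mean {K : ℕ} (μhat : Fin K → ℝ) (N : Fin K → ℕ) (i : Fin K) :
    ∫ θ, θ i ∂(gaussPosterior K μhat N) = μhat i := by
  have := (measurePreserving_eval (fun i => gaussianReal (μhat i) ((N i : ℝ≥0))⁻¹) i).map_eq
  rw [← integral_id_gaussianReal (μ := μhat i) (v := (N i : ℝ≥0)⁻¹), ← this,
    integral_map (measurable_pi_apply i).aemeasurable (by fun_prop)]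
  rfl

set_option maxHeartbeats 2000000

/-- Saturated-regime bound on `π_j`: if arm 1 is not underestimated, arm `j` is not
overestimated, and both `N_1 ≥ 3T_j` and `N_j ≥ 3T_j`, then at a ReMax optimum
`π_j ≤ (8/(√π·Δ_j)) exp(−1.5·T_j·(Δ_j − 2ε)²/2)`. -/
theorem saturated_pi_j_bound
    (K : ℕ) (hK : 2 ≤ K)
    (μhat : Fin K → ℝ) (N : Fin K → ℕ) (hN : ∀ i, 1 ≤ N i)
    (π : Fin K → ℝ) (hπ0 : ∀ i, 0 ≤ π i) (hπ1 : ∑ i, π i = 1)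
    (hmax : ∀ π' : Fin K → ℝ, (∀ i, 0 ≤ π' i) → (∑ i, π' i = 1) →
      remaxJ2 K μhat N π' ≤ remaxJ2 K μhat N π)
    (i1 : Fin K) (hi1 : (i1 : ℕ) = 0) (j : Fin K) (hj : j ≠ i1)
    (μ₁ μj : ℝ) (hgap : μj < μ₁)
    (Tj : ℝ) (hTj : 0 < Tj)
    (ε : ℝ) (hε : 0 < ε) (hε' : ε ≤ (μ₁ - μj) / 4)
    (h1 : μ₁ - ε ≤ μhat i1) (hjv : μhat j ≤ μj + ε)
    (hN1 : 3 * Tj ≤ (N i1 : ℝ)) (hNj : 3 * Tj ≤ (N j : ℝ)) :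
    π j ≤ (8 / (Real.sqrt Real.pi * (μ₁ - μj))) *
        Real.exp (-1.5 * Tj * (μ₁ - μj - 2 * ε) ^ 2 / 2) := by
  set D := μhat i1 - μhat j with hD
  have hDge : μ₁ - μj - 2 * ε ≤ D := by linarith
  have hDhalf : (μ₁ - μj) / 2 ≤ D := by linarith
  have hDpos : 0 < D := by linarith
  set P := gaussPosterior K μhat N with hP
  set v : ℝ≥0 := (N j : ℝ≥0)⁻¹ + (N i1 : ℝ≥0)⁻¹ with hv
  have n1 : (1 : ℝ) ≤ N i1 := by exact_mod_cast hN i1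
  have nj : (1 : ℝ) ≤ N j := by exact_mod_cast hN j
  have hvr : (v : ℝ) = (N j : ℝ)⁻¹ + (N i1 : ℝ)⁻¹ := by simp [hv]
  have hvpos : (0 : ℝ) < v := by rw [hvr]; positivity
  have hv2 : (v : ℝ) ≤ 2 := by
    rw [hvr]; linarith [inv_le_one_of_one_le₀ n1, inv_le_one_of_one_le₀ nj]
  have hvT : (v : ℝ) ≤ 2 * (3 * Tj)⁻¹ := by
    rw [hvr]
    linarith [inv_anti₀ (by positivity) hN1, inv_anti₀ (by positivity) hNj]
  have hvT' : 3 * Tj * v ≤ 2 := by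
    have := mul_le_mul_of_nonneg_left hvT (by positivity : 0 ≤ 3 * Tj)
    have h3 : 3 * Tj * (2 * (3 * Tj)⁻¹) = 2 := by field_simp
    linarith
  have hE : ∫ θ, max (θ j - θ i1) 0 ∂P ≤ Real.exp (-D ^ 2 / (2 * v)) := by
    have h := aux_gauss D hDpos.le v (by intro h; simp [h] at hvpos) hv2
    rw [← aux_law μhat N i1 j hj, integral_map (by fun_prop) (by fun_prop)] at h
    exact h
  have hexp : Real.exp (-D ^ 2 / (2 * v)) ≤
      Real.exp (-1.5 * Tj * (μ₁ - μj - 2 * ε) ^ 2 / 2) := by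
    apply Real.exp_le_exp.2
    rw [div_le_iff₀ (by positivity)]
    have h5 : (μ₁ - μj - 2 * ε) ^ 2 ≤ D ^ 2 := by
      apply pow_le_pow_left₀ _ hDge
      linarith
    have h6 := mul_le_mul_of_nonneg_right hvT' (sq_nonneg (μ₁ - μj - 2 * ε))
    nlinarith
  set E := Real.exp (-1.5 * Tj * (μ₁ - μj - 2 * ε) ^ 2 / 2) with hEdef
  have hEpos : 0 < E := Real.exp_pos _
  set π' : Fin K → ℝ :=
    fun k => π k + π j * ((if k = i1 then 1 else 0) - (if k = j then 1 else 0)) with hπ'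
  have hp0 := hπ0 j
  have g0 : ∀ i, 0 ≤ π' i := by
    intro i
    simp only [hπ']
    have := hπ0 i
    by_cases h2 : i = j
    · subst h2; simp [hj]
    · split_ifs <;> simp <;> linarith
  have g1 : ∑ i, π' i = 1 := by
    have := aux_lin i1 j π (fun _ => 1) (π j)
    simpa [hπ1] using this
  have hJ := hmax π' g0 g1
  have hint : ∀ w : Fin K → ℝ,
      Integrable (fun θ : Fin K → ℝ => ∑ i, ∑ k, w i * w k * max (θ i) (θ k)) P := fun w =>
    integrable_finsetSum _ fun i _ => integrable_finsetSum _ fun k _ =>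
      ((aux_int μhat N i).sup (aux_int μhat N k)).const_mul _
  have hA : Integrable (fun θ : Fin K → ℝ => π j ^ 2 * (θ i1 - θ j)) P :=
    ((aux_int μhat N i1).sub (aux_int μhat N j)).const_mul _
  have hB : Integrable (fun θ : Fin K → ℝ => 2 * π j * max (θ j - θ i1) 0) P :=
    (((aux_int μhat N j).sub (aux_int μhat N i1)).pos_part).const_mul _
  have hmono := integral_mono ((hA.sub hB).add (hint π)) (hint π')
    (fun θ => aux_path i1 j hj π θ hπ0 hπ1 π' rfl)
  rw [integral_add' (hA.sub hB) (hint π), integral_sub' hA hB, integral_const_mul,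
    integral_const_mul, integral_sub (aux_int μhat N i1) (aux_int μhat N j),
    aux_mean, aux_mean] at hmono
  unfold remaxJ2 at hJ
  have hfin : π j ^ 2 * D - 2 * π j * ∫ θ, max (θ j - θ i1) 0 ∂P ≤ 0 := by linarith
  have hmain : π j * D ≤ 2 * E := by
    rcases hp0.eq_or_lt with h0 | h0
    · rw [← h0]; linarith
    · have : π j * (π j * D) ≤ π j * (2 * E) := by nlinarith
      exact le_of_mul_le_mul_left this h0
  have hsp : Real.sqrt Real.pi ≤ 2 := by
    rw [Real.sqrt_le_left (by norm_num)]
    linarith [Real.pi_le_four]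
  have hspp : 0 < Real.sqrt Real.pi := Real.sqrt_pos.2 Real.pi_pos
  have hg : 0 < μ₁ - μj := by linarith
  rw [div_mul_eq_mul_div, le_div_iff₀ (by positivity)]
  have h7 : π j * (μ₁ - μj) ≤ 4 * E := by nlinarith
  have h8 : 0 ≤ π j * (μ₁ - μj) := by positivity
  nlinarith
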